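/- arXiv:math/0605744 — 3 statements merged into one kernel-verified Lean document; each statement's English description precedes it below -/
import Mathlib

section
/- Let n ≥ 2, let k be a natural number, let i_1, …, i_k ∈ {1, …, n−1}, and let w_1, …, w_k be elements of the submonoid of B_{n+2} generated by σ_1, …, σ_{n−1}. Define α ∈ B_{n+2} by α = σ_{n+1} σ_n · ∏_{l=1}^{k} [ (σ_n σ_{n−1} ⋯ σ_{i_l}) · (σ_{n+1} σ_n ⋯ σ_{i_l+1}) · σ_{i_l+2}^{-1} · σ_{i_l+1} · (σ_{i_l+2} σ_{i_l+3} ⋯ σ_{n+1}) · (σ_{i_l} σ_{i_l+1} ⋯ σ_n) · w_l ], where σ_n σ_{n−1} ⋯ σ_{i_l} denotes the product of the generators with consecutively decreasing indices from n down to i_l, and σ_{i_l+2} ⋯ σ_{n+1} and σ_{i_l} ⋯ σ_n denote products with consecutively increasing indices. Then α is quasipositive, i.e., α lies in the submonoid of B_{n+2} generated by all elements of the form g σ_j g^{-1} with g ∈ B_{n+2} and 1 ≤ j ≤ n+1. -/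
/-- The braid relations on `m - 1` generators `σ_1, …, σ_{m-1}` (0-indexed by `Fin (m-1)`):
the braid relation `σ_i σ_{i+1} σ_i = σ_{i+1} σ_i σ_{i+1}` and the far commutation
relation `σ_i σ_j = σ_j σ_i` for `|i - j| ≥ 2`. -/
def braidRels (m : ℕ) : Set (FreeGroup (Fin (m - 1))) :=
  {r | (∃ i j : Fin (m - 1), (j : ℕ) = (i : ℕ) + 1 ∧
          r = FreeGroup.of i * FreeGroup.of j * FreeGroup.of i *
              (FreeGroup.of j * FreeGroup.of i * FreeGroup.of j)⁻¹) ∨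
       (∃ i j : Fin (m - 1), (i : ℕ) + 2 ≤ (j : ℕ) ∧
          r = FreeGroup.of i * FreeGroup.of j * (FreeGroup.of j * FreeGroup.of i)⁻¹)}

/-- The braid group `B_m` on `m` strings, presented with generators `σ_1, …, σ_{m-1}`
and the braid relations. -/
abbrev BraidGroup (m : ℕ) : Type := PresentedGroup (braidRels m)

/-- The standard generator `σ_i` of the braid group `B_m`, for `1 ≤ i ≤ m - 1`
(junk value `1` outside this range). -/
noncomputable def σ (m i : ℕ) : BraidGroup m :=
  if h : 1 ≤ i ∧ i ≤ m - 1 then PresentedGroup.of (⟨i - 1, by omega⟩ : Fin (m - 1)) else 1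

/-- The ascending product `σ_lo σ_{lo+1} ⋯ σ_hi` in `B_m`. -/
noncomputable def σAsc (m lo hi : ℕ) : BraidGroup m :=
  ((List.range' lo (hi + 1 - lo)).map (σ m)).prod

/-- The descending product `σ_hi σ_{hi-1} ⋯ σ_lo` in `B_m`. -/
noncomputable def σDesc (m hi lo : ℕ) : BraidGroup m :=
  ((List.range' lo (hi + 1 - lo)).reverse.map (σ m)).prod

/-- The submonoid of quasipositive braids in `B_{n+2}`. -/
def quasipositive (n : ℕ) : Submonoid (BraidGroup (n + 2)) :=
  Submonoid.closure {x : BraidGroup (n + 2) |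
    ∃ (g : BraidGroup (n + 2)) (j : ℕ), 1 ≤ j ∧ j ≤ n + 1 ∧ x = g * σ (n + 2) j * g⁻¹}

theorem conj_σ_mem_quasipositive {n j : ℕ} (g : BraidGroup (n + 2)) (h₁ : 1 ≤ j)
    (h₂ : j ≤ n + 1) : g * σ (n + 2) j * g⁻¹ ∈ quasipositive n :=
  Submonoid.subset_closure ⟨g, j, h₁, h₂, rfl⟩

theorem σ_mem_quasipositive {n j : ℕ} (h₁ : 1 ≤ j) (h₂ : j ≤ n + 1) :
    σ (n + 2) j ∈ quasipositive n := by
  simpa using conj_σ_mem_quasipositive 1 h₁ h₂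

theorem σAsc_mem_quasipositive {n lo hi : ℕ} (h₁ : 1 ≤ lo) (h₂ : hi ≤ n + 1) :
    σAsc (n + 2) lo hi ∈ quasipositive n := by
  refine Submonoid.list_prod_mem _ fun x hx => ?_
  obtain ⟨j, hj, rfl⟩ := List.mem_map.1 hx
  rw [List.mem_range'_1] at hj
  exact σ_mem_quasipositive (by omega) (by omega)

theorem σDesc_mem_quasipositive {n lo hi : ℕ} (h₁ : 1 ≤ lo) (h₂ : hi ≤ n + 1) :
    σDesc (n + 2) hi lo ∈ quasipositive n := by
  refine Submonoid.list_prod_mem _ fun x hx => ?_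
  obtain ⟨j, hj, rfl⟩ := List.mem_map.1 hx
  rw [List.mem_reverse, List.mem_range'_1] at hj
  exact σ_mem_quasipositive (by omega) (by omega)

theorem σAsc_eq_mul {m lo hi : ℕ} (h : lo ≤ hi) :
    σAsc m lo hi = σ m lo * σAsc m (lo + 1) hi := by
  have hlen : hi + 1 - lo = (hi + 1 - (lo + 1)) + 1 := by omega
  rw [σAsc, hlen, List.range'_succ, List.map_cons, List.prod_cons, σAsc]

/-- The negative letter `σ_{i+2}⁻¹` is absorbed in the conjugate
`σ_{i+2}⁻¹ σ_{i+1} σ_{i+2}` of `σ_{i+1}`. -/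
theorem inv_σ_mul_σ_mul_σAsc_mem_quasipositive {n i : ℕ} (h : i + 1 ≤ n) :
    (σ (n + 2) (i + 2))⁻¹ * σ (n + 2) (i + 1) * σAsc (n + 2) (i + 2) (n + 1) ∈
      quasipositive n := by
  rw [σAsc_eq_mul (by omega), ← mul_assoc]
  refine mul_mem ?_ (σAsc_mem_quasipositive (by omega) le_rfl)
  simpa using conj_σ_mem_quasipositive (σ (n + 2) (i + 2))⁻¹ (j := i + 1) (by omega) (by omega)

/-- **The braid `α` of equation (2) is quasipositive.** Let `n ≥ 2`, `1 ≤ i_l ≤ n - 1`,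
and let `w_1, …, w_k` lie in the submonoid of `B_{n+2}` generated by `σ_1, …, σ_{n-1}`.
Then
`α = σ_{n+1} σ_n ∏_{l=1}^k (σ_n ⋯ σ_{i_l})(σ_{n+1} ⋯ σ_{i_l+1}) σ_{i_l+2}⁻¹ σ_{i_l+1}
(σ_{i_l+2} ⋯ σ_{n+1})(σ_{i_l} ⋯ σ_n) w_l`
lies in the submonoid of `B_{n+2}` generated by all conjugates `g σ_j g⁻¹` of the
standard generators (`1 ≤ j ≤ n + 1`), i.e. `α` is quasipositive. -/
theorem alpha_is_quasipositive
    (n : ℕ) (hn : 2 ≤ n) (k : ℕ) (i : Fin k → ℕ)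
    (hi : ∀ l : Fin k, 1 ≤ i l ∧ i l ≤ n - 1)
    (w : Fin k → BraidGroup (n + 2))
    (hw : ∀ l : Fin k, w l ∈
      Submonoid.closure {x : BraidGroup (n + 2) | ∃ j : ℕ, 1 ≤ j ∧ j ≤ n - 1 ∧ x = σ (n + 2) j}) :
    σ (n + 2) (n + 1) * σ (n + 2) n *
      (List.ofFn fun l : Fin k =>
        σDesc (n + 2) n (i l) * σDesc (n + 2) (n + 1) (i l + 1) *
          (σ (n + 2) (i l + 2))⁻¹ * σ (n + 2) (i l + 1) *
          σAsc (n + 2) (i l + 2) (n + 1) * σAsc (n + 2) (i l) n * w l).prod ∈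
      Submonoid.closure {x : BraidGroup (n + 2) |
        ∃ (g : BraidGroup (n + 2)) (j : ℕ), 1 ≤ j ∧ j ≤ n + 1 ∧ x = g * σ (n + 2) j * g⁻¹} := by
  change _ ∈ quasipositive n
  refine mul_mem (mul_mem (σ_mem_quasipositive (by omega) le_rfl)
    (σ_mem_quasipositive (by omega) (by omega))) (Submonoid.list_prod_mem _ fun x hx => ?_)
  obtain ⟨l, rfl⟩ := List.mem_ofFn.1 hx
  obtain ⟨h₁, h₂⟩ := hi l
  have hw_mem : w l ∈ quasipositive n := by
    refine Submonoid.closure_le.2 ?_ (hw l)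
    rintro _ ⟨j, hj₁, hj₂, rfl⟩
    exact σ_mem_quasipositive hj₁ (by omega)
  have hD := mul_mem (σDesc_mem_quasipositive (n := n) (hi := n) h₁ (by omega))
    (σDesc_mem_quasipositive (n := n) (lo := i l + 1) (hi := n + 1) (by omega) le_rfl)
  have hA := σAsc_mem_quasipositive (n := n) (hi := n) h₁ (by omega)
  have hmid := inv_σ_mul_σ_mul_σAsc_mem_quasipositive (n := n) (i := i l) (by omega)
  simpa only [mul_assoc] using mul_mem (mul_mem (mul_mem hD hmid) hA) hw_mem
end

section
/- Let n ≥ 2, let k be a natural number, let i_1, …, i_k ∈ {1, …, n−1}, and let w_1, …, w_k be elements of the submonoid of B_{n+2} generated by σ_1, …, σ_{n−1}. Define α ∈ B_{n+2} by α = σ_{n+1} σ_n · ∏_{l=1}^{k} [ (σ_n σ_{n−1} ⋯ σ_{i_l}) · (σ_{n+1} σ_n ⋯ σ_{i_l+1}) · σ_{i_l+2}^{-1} · σ_{i_l+1} · (σ_{i_l+2} σ_{i_l+3} ⋯ σ_{n+1}) · (σ_{i_l} σ_{i_l+1} ⋯ σ_n) · w_l ], where σ_n σ_{n−1} ⋯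 σ_{i_l} denotes the product of the generators with consecutively decreasing indices from n down to i_l, and σ_{i_l+2} ⋯ σ_{n+1} and σ_{i_l} ⋯ σ_n denote products with consecutively increasing indices. Then α is strongly quasipositive, i.e., α lies in the submonoid of B_{n+2} generated by the band generators a_{i,j} = (σ_{j−1} σ_{j−2} ⋯ σ_{i+1}) · σ_i · (σ_{i+1}^{-1} σ_{i+2}^{-1} ⋯ σ_{j−1}^{-1}) for 1 ≤ i < j ≤ n+2. -/
/-- The band generator `a_{i,j} = (σ_{j-1} σ_{j-2} ⋯ σ_{i+1}) σ_i (σ_{i+1}⁻¹ σ_{i+2}⁻¹ ⋯ σ_{j-1}⁻¹)`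
of the braid group `B_m`, for `1 ≤ i < j ≤ m`. -/
noncomputable def bandGen (m i j : ℕ) : BraidGroup m :=
  σDesc m (j - 1) (i + 1) * σ m i * (σDesc m (j - 1) (i + 1))⁻¹

theorem σ_braid {m i : ℕ} (h1 : 1 ≤ i) (h2 : i + 2 ≤ m) :
    σ m i * σ m (i + 1) * σ m i = σ m (i + 1) * σ m i * σ m (i + 1) := by
  rw [σ, σ, dif_pos (by omega), dif_pos (by omega), ← mul_inv_eq_one]
  exact PresentedGroup.one_of_mem (rels := braidRels m)
    (Or.inl ⟨⟨i - 1, by omega⟩, ⟨i + 1 - 1, by omega⟩, by simp only; omega, rfl⟩)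

theorem σ_commute {m i j : ℕ} (h1 : 1 ≤ i) (h2 : i + 2 ≤ j) (h3 : j + 1 ≤ m) :
    Commute (σ m i) (σ m j) := by
  rw [Commute, SemiconjBy, σ, σ, dif_pos (by omega), dif_pos (by omega), ← mul_inv_eq_one]
  exact PresentedGroup.one_of_mem (rels := braidRels m)
    (Or.inr ⟨⟨i - 1, by omega⟩, ⟨j - 1, by omega⟩, by simp only; omega, rfl⟩)

theorem σDesc_eq_mul_σ (m : ℕ) {hi lo : ℕ} (h : lo ≤ hi) :
    σDesc m hi lo = σDesc m hi (lo + 1) * σ m lo := by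
  rw [σDesc, σDesc, show hi + 1 - lo = (hi + 1 - (lo + 1)) + 1 by omega, List.range'_succ]
  simp

theorem σ_commute_σDesc {m i hi lo : ℕ} (h1 : 1 ≤ i) (h2 : i + 2 ≤ lo) (h3 : hi + 1 ≤ m) :
    Commute (σ m i) (σDesc m hi lo) := by
  refine Commute.list_prod_right _ _ fun x hx => ?_
  obtain ⟨j, hj, rfl⟩ := List.mem_map.1 hx
  rw [List.mem_reverse, List.mem_range'_1] at hj
  exact σ_commute h1 (by omega) (by omega)

/-- A descending product conjugates `σ_{lo+1}` to `σ_lo`. -/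
theorem σDesc_mul_σ_inv {m hi lo : ℕ} (h1 : 1 ≤ lo) (h2 : lo < hi) (h3 : hi + 1 ≤ m) :
    σDesc m hi lo * (σ m (lo + 1))⁻¹ = (σ m lo)⁻¹ * σDesc m hi lo := by
  have hc := σ_commute_σDesc h1 (le_refl (lo + 2)) h3
  rw [mul_inv_eq_iff_eq_mul, mul_assoc, eq_inv_mul_iff_mul_eq, σDesc_eq_mul_σ m h2.le,
    σDesc_eq_mul_σ m (Nat.succ_le_of_lt h2)]
  simp only [← mul_assoc]
  rw [hc.eq]
  simp only [mul_assoc]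
  rw [← mul_assoc (σ m lo), σ_braid h1 (by omega), mul_assoc]

theorem bandGen_add_two (m i : ℕ) :
    bandGen m i (i + 2) = σ m (i + 1) * σ m i * (σ m (i + 1))⁻¹ := by
  simp [bandGen, σDesc]

theorem bandGen_succ (m i : ℕ) : bandGen m i (i + 1) = σ m i := by
  simp [bandGen, σDesc]

theorem σDesc_mul_σDesc_mul_σ_inv {n i : ℕ} (h1 : 1 ≤ i) (h2 : i < n) :
    σDesc (n + 2) n i * σDesc (n + 2) (n + 1) (i + 1) * (σ (n + 2) (i + 2))⁻¹ =
      σDesc (n + 2) n (i + 2) * bandGen (n + 2) i (i + 2) * σDesc (n + 2) (n + 1) (i + 1) := by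
  rw [mul_assoc, σDesc_mul_σ_inv (by omega) (by omega) le_rfl, bandGen_add_two,
    σDesc_eq_mul_σ _ h2.le, σDesc_eq_mul_σ _ (Nat.succ_le_of_lt h2)]
  simp only [mul_assoc]

/-- The submonoid of strongly quasipositive braids in `B_m`. -/
def stronglyQuasipositive (m : ℕ) : Submonoid (BraidGroup m) :=
  Submonoid.closure {x | ∃ a b : ℕ, 1 ≤ a ∧ a < b ∧ b ≤ m ∧ x = bandGen m a b}

theorem bandGen_mem_stronglyQuasipositive {m a b : ℕ} (ha : 1 ≤ a) (hab : a < b) (hb : b ≤ m) :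
    bandGen m a b ∈ stronglyQuasipositive m :=
  Submonoid.subset_closure ⟨a, b, ha, hab, hb, rfl⟩

theorem σ_mem_stronglyQuasipositive (m i : ℕ) : σ m i ∈ stronglyQuasipositive m := by
  by_cases h : 1 ≤ i ∧ i ≤ m - 1
  · rw [← bandGen_succ]
    exact bandGen_mem_stronglyQuasipositive h.1 i.lt_succ_self (by omega)
  · rw [σ, dif_neg h]
    exact one_mem _

theorem σDesc_mem_stronglyQuasipositive (m hi lo : ℕ) :
    σDesc m hi lo ∈ stronglyQuasipositive m := by
  refine Submonoid.list_prod_mem _ fun x hx => ?_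
  obtain ⟨j, -, rfl⟩ := List.mem_map.1 hx
  exact σ_mem_stronglyQuasipositive m j

theorem σAsc_mem_stronglyQuasipositive (m lo hi : ℕ) :
    σAsc m lo hi ∈ stronglyQuasipositive m := by
  refine Submonoid.list_prod_mem _ fun x hx => ?_
  obtain ⟨j, -, rfl⟩ := List.mem_map.1 hx
  exact σ_mem_stronglyQuasipositive m j

/-- **Remark 1 of the paper: the braid `α` of equation (2) is strongly quasipositive.**
Let `n ≥ 2`, `1 ≤ i_l ≤ n - 1`, and let `w_1, …, w_k` lie in the submonoid of `B_{n+2}`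
generated by `σ_1, …, σ_{n-1}`. Then
`α = σ_{n+1} σ_n ∏_{l=1}^k (σ_n ⋯ σ_{i_l})(σ_{n+1} ⋯ σ_{i_l+1}) σ_{i_l+2}⁻¹ σ_{i_l+1}
(σ_{i_l+2} ⋯ σ_{n+1})(σ_{i_l} ⋯ σ_n) w_l`
lies in the submonoid of `B_{n+2}` generated by the band generators `a_{i,j}`,
`1 ≤ i < j ≤ n + 2`, i.e. `α` is strongly quasipositive. -/
theorem alpha_is_strongly_quasipositive
    (n : ℕ) (hn : 2 ≤ n) (k : ℕ) (i : Fin k → ℕ)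
    (hi : ∀ l : Fin k, 1 ≤ i l ∧ i l ≤ n - 1)
    (w : Fin k → BraidGroup (n + 2))
    (hw : ∀ l : Fin k, w l ∈
      Submonoid.closure {x : BraidGroup (n + 2) | ∃ j : ℕ, 1 ≤ j ∧ j ≤ n - 1 ∧ x = σ (n + 2) j}) :
    σ (n + 2) (n + 1) * σ (n + 2) n *
      (List.ofFn fun l : Fin k =>
        σDesc (n + 2) n (i l) * σDesc (n + 2) (n + 1) (i l + 1) *
          (σ (n + 2) (i l + 2))⁻¹ * σ (n + 2) (i l + 1) *
          σAsc (n + 2) (i l + 2) (n + 1) * σAsc (n + 2) (i l) n * w l).prod ∈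
      Submonoid.closure {x : BraidGroup (n + 2) |
        ∃ a b : ℕ, 1 ≤ a ∧ a < b ∧ b ≤ n + 2 ∧ x = bandGen (n + 2) a b} := by
  change _ ∈ stronglyQuasipositive (n + 2)
  refine mul_mem (mul_mem (σ_mem_stronglyQuasipositive _ _) (σ_mem_stronglyQuasipositive _ _))
    (Submonoid.list_prod_mem _ fun x hx => ?_)
  obtain ⟨l, rfl⟩ := (List.mem_ofFn' _ _).1 hx
  obtain ⟨h1, h2⟩ := hi l
  have hwl : w l ∈ stronglyQuasipositive (n + 2) := by
    refine Submonoid.closure_le.2 ?_ (hw l)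
    rintro _ ⟨j, -, -, rfl⟩
    exact σ_mem_stronglyQuasipositive _ j
  beta_reduce
  rw [σDesc_mul_σDesc_mul_σ_inv h1 (by omega)]
  have hb := bandGen_mem_stronglyQuasipositive (m := n + 2) h1 (Nat.lt_add_of_pos_right two_pos)
    (by omega)
  exact mul_mem (mul_mem (mul_mem (mul_mem (mul_mem (mul_mem
    (σDesc_mem_stronglyQuasipositive _ _ _) hb) (σDesc_mem_stronglyQuasipositive _ _ _))
    (σ_mem_stronglyQuasipositive _ _)) (σAsc_mem_stronglyQuasipositive _ _ _))
    (σAsc_mem_stronglyQuasipositive _ _ _)) hwl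
end

section
/- Let n ≥ 2, let k be a natural number, let i_1, …, i_k ∈ {1, …, n−1}, and let w_1, …, w_k be elements of the submonoid of B_n generated by σ_1, …, σ_{n−1}. Let β = ∏_{l=1}^{k} σ_{i_l}^{-1} w_l ∈ B_n, and let α ∈ B_{n+2} be defined by α = σ_{n+1} σ_n · ∏_{l=1}^{k} [ (σ_n σ_{n−1} ⋯ σ_{i_l}) · (σ_{n+1} σ_n ⋯ σ_{i_l+1}) · σ_{i_l+2}^{-1} · σ_{i_l+1} · (σ_{i_l+2} σ_{i_l+3} ⋯ σ_{n+1}) · (σ_{i_l} σ_{i_l+1} ⋯ σ_n) · ι(w_l) ], where ι : B_n → B_{n+2} is the homomorphism sending σ_i to σ_i. If the image of β under the canonical projection π_n : B_n → S_n (sending σ_i to the transposition (i, i+1)) is a cycle of length n, then the image of α under the canonical projection π_{n+2} : B_{n+2} → S_{n+2} is a cycle of length n+2. -/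
/-- A letter outside the support of a cycle can be spliced in by a transposition. -/
lemma isCycle_swap_mul_of_notMem_support {α : Type*} [Fintype α] [DecidableEq α]
    {c : Equiv.Perm α} (hc : c.IsCycle) {x y : α} (hx : x ∈ c.support) (hy : y ∉ c.support) :
    (Equiv.swap y x * c).IsCycle ∧ (Equiv.swap y x * c).support = insert y c.support := by
  obtain ⟨l, hl⟩ : ∃ l, c.toList x = x :: l := by
    obtain ⟨a, l, h⟩ :=
      List.exists_cons_of_length_pos (Equiv.Perm.length_toList_pos_of_mem_support c x hx)
    have hx0 := Equiv.Perm.toList_getElem_zero c x hx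
    simp only [h, List.getElem_cons_zero] at hx0
    exact ⟨l, by rw [h, hx0]⟩
  have hform : (x :: l).formPerm = c := by
    rw [← hl, Equiv.Perm.formPerm_toList, hc.cycleOf_eq (Equiv.Perm.mem_support.1 hx)]
  have hnodup : (x :: l).Nodup := hl ▸ Equiv.Perm.nodup_toList c x
  have hmem (z : α) : z ∈ x :: l ↔ z ∈ c.support := by
    rw [← hl, Equiv.Perm.mem_toList_iff]
    exact ⟨fun h => h.1.mem_support_iff.1 h.2,
      fun h => ⟨hc.sameCycle (Equiv.Perm.mem_support.1 hx) (Equiv.Perm.mem_support.1 h), hx⟩⟩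
  have hnodup' : (y :: x :: l).Nodup := List.nodup_cons.2 ⟨fun h => hy ((hmem y).1 h), hnodup⟩
  have heq : Equiv.swap y x * c = (y :: x :: l).formPerm := by
    rw [List.formPerm_cons_cons, hform]
  rw [heq]
  refine ⟨List.isCycle_formPerm hnodup' (by simp), ?_⟩
  rw [List.support_formPerm_of_nodup _ hnodup' (by simp)]
  ext z
  rw [List.mem_toFinset, List.mem_cons, Finset.mem_insert, hmem]

/-- The product of the adjacent transpositions of indices `lo, …, lo + len - 1` fixes the letters
below and shifts the letters it meets, except the last one. -/
lemma prod_adjacent_swaps_apply {m : ℕ} (τ : ℕ → Equiv.Perm (Fin m))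
    (hτ : ∀ (j : ℕ) (h1 : 1 ≤ j) (h2 : j < m), τ j = Equiv.swap ⟨j - 1, by omega⟩ ⟨j, h2⟩)
    (len lo : ℕ) (hlo : 1 ≤ lo) (hm : lo + len ≤ m) :
    (∀ (x : ℕ) (hx : x < m), x + 1 < lo → ((List.range' lo len).map τ).prod ⟨x, hx⟩ = ⟨x, hx⟩) ∧
    ∀ (x : ℕ) (hx : x + 1 < m), lo ≤ x + 1 → x + 1 < lo + len →
      ((List.range' lo len).map τ).prod ⟨x, by omega⟩ = ⟨x + 1, hx⟩ := by
  induction len generalizing lo with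
  | zero => exact ⟨fun x hx h => by simp, fun x hx h h' => by omega⟩
  | succ len ih =>
    obtain ⟨h1, h2⟩ := ih (lo + 1) (by omega) (by omega)
    rw [List.range'_succ, List.map_cons, List.prod_cons, hτ lo hlo (by omega)]
    refine ⟨fun x hx h => ?_, fun x hx h h' => ?_⟩
    · rw [Equiv.Perm.mul_apply, h1 x hx (by omega)]
      exact Equiv.swap_apply_of_ne_of_ne (by simp; omega) (by simp; omega)
    · rw [Equiv.Perm.mul_apply]
      rcases eq_or_lt_of_le h with rfl | h
      · rw [h1 x (by omega) (by omega)]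
        exact Equiv.swap_apply_left _ _
      · rw [h2 x hx h (by omega)]
        exact Equiv.swap_apply_of_ne_of_ne (by simp; omega) (by simp; omega)

/-- If the generators map to involutions, descending products map to inverses of ascending ones. -/
lemma map_σDesc_eq_inv {G : Type*} [Group G] (m hi lo : ℕ) (π : BraidGroup m →* G)
    (hinv : ∀ j, lo ≤ j → j ≤ hi → (π (σ m j))⁻¹ = π (σ m j)) :
    π (σDesc m hi lo) = (π (σAsc m lo hi))⁻¹ := by
  rw [σDesc, σAsc, map_list_prod, map_list_prod, List.prod_inv_reverse, List.map_map, List.map_map,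
    List.map_map, ← List.map_reverse]
  congr 1
  refine List.map_congr_left fun j hj => ?_
  rw [List.mem_reverse, List.mem_range'_1] at hj
  exact (hinv j hj.1 (by omega)).symm

/-- The conjugated block replacing `σ_i⁻¹` in the braid `α` has the permutation of `σ_i`. -/
lemma map_block_eq {n : ℕ} (π : BraidGroup (n + 2) →* Equiv.Perm (Fin (n + 2)))
    (hπ : ∀ (j : ℕ) (_ : 1 ≤ j) (h : j < n + 2),
      π (σ (n + 2) j) = Equiv.swap ⟨j - 1, (Nat.sub_le j 1).trans_lt h⟩ ⟨j, h⟩)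
    (i : ℕ) (h1 : 1 ≤ i) (h2 : i + 1 ≤ n) :
    π (σDesc (n + 2) n i * σDesc (n + 2) (n + 1) (i + 1) * (σ (n + 2) (i + 2))⁻¹ *
      σ (n + 2) (i + 1) * σAsc (n + 2) (i + 2) (n + 1) * σAsc (n + 2) i n) =
    π (σ (n + 2) i) := by
  have hinv (j : ℕ) (h1 : 1 ≤ j) (h2 : j ≤ n + 1) : (π (σ (n + 2) j))⁻¹ = π (σ (n + 2) j) := by
    rw [hπ j h1 (by omega), Equiv.swap_inv]
  have hsplit : σAsc (n + 2) (i + 1) (n + 1) =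
      σ (n + 2) (i + 1) * σAsc (n + 2) (i + 2) (n + 1) := by
    rw [σAsc, σAsc, show n + 1 + 1 - (i + 1) = (n + 1 + 1 - (i + 2)) + 1 by omega,
      List.range'_succ, List.map_cons, List.prod_cons]
  have hA := (prod_adjacent_swaps_apply (fun j => π (σ (n + 2) j)) hπ (n + 1 - i) i h1
    (by omega)).2
  have hB := prod_adjacent_swaps_apply (fun j => π (σ (n + 2) j)) hπ (n + 1 + 1 - (i + 2)) (i + 2)
    (by omega) (by omega)
  have hA' : π (σAsc (n + 2) i n) =
      ((List.range' i (n + 1 - i)).map fun j => π (σ (n + 2) j)).prod := by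
    rw [σAsc, map_list_prod, List.map_map]; rfl
  have hB' : π (σAsc (n + 2) (i + 2) (n + 1)) =
      ((List.range' (i + 2) (n + 1 + 1 - (i + 2))).map fun j => π (σ (n + 2) j)).prod := by
    rw [σAsc, map_list_prod, List.map_map]; rfl
  rw [← hA'] at hA
  rw [← hB'] at hB
  simp only [map_mul, map_inv]
  rw [map_σDesc_eq_inv _ _ _ π fun j hj hj' => hinv j (by omega) (by omega),
    map_σDesc_eq_inv _ _ _ π fun j hj hj' => hinv j (by omega) (by omega), hsplit, map_mul,
    hinv (i + 2) (by omega) (by omega)]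
  generalize π (σAsc (n + 2) i n) = A at *
  generalize π (σAsc (n + 2) (i + 2) (n + 1)) = B at *
  have e1 : (B * A) ⟨i - 1, by omega⟩ = ⟨i, by omega⟩ := by
    have := hA (i - 1) (by omega) (by omega) (by omega)
    rw [Equiv.Perm.mul_apply, this]
    simp only [Nat.sub_add_cancel h1]
    exact hB.1 i (by omega) (by omega)
  have e2 : (B * A) ⟨i, by omega⟩ = ⟨i + 2, by omega⟩ := by
    rw [Equiv.Perm.mul_apply, hA i (by omega) (by omega) (by omega)]
    exact hB.2 (i + 1) (by omega) (by omega) (by omega)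
  have hsts : π (σ (n + 2) (i + 1)) * π (σ (n + 2) (i + 2)) * π (σ (n + 2) (i + 1)) =
      Equiv.swap (⟨i, by omega⟩ : Fin (n + 2)) ⟨i + 2, by omega⟩ := by
    rw [hπ (i + 1) (by omega) (by omega), hπ (i + 2) (by omega) (by omega)]
    have h := Equiv.swap_apply_apply (Equiv.swap (⟨i, by omega⟩ : Fin (n + 2)) ⟨i + 1, by omega⟩)
      ⟨i + 1, by omega⟩ ⟨i + 2, by omega⟩
    rw [Equiv.swap_apply_right, Equiv.swap_apply_of_ne_of_ne (by simp) (by simp),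
      Equiv.swap_inv] at h
    exact h.symm
  have hconj := Equiv.swap_apply_apply (B * A) ⟨i - 1, by omega⟩ ⟨i, by omega⟩
  rw [e1, e2, ← hπ i h1 (by omega), ← hsts] at hconj
  have hs := hinv (i + 1) (by omega) (by omega)
  rw [mul_inv_rev, hs]
  calc _ = (B * A)⁻¹ * (π (σ (n + 2) (i + 1)) * π (σ (n + 2) (i + 2)) *
        π (σ (n + 2) (i + 1))) * (B * A) := by group
    _ = _ := by rw [hconj]; group

/-- **If the closure of `β` is a knot, the closure of `α` is a knot.** Let `n ≥ 2`,
`β = ∏_{l=1}^k σ_{i_l}⁻¹ w_l ∈ B_n` in the normal form (1) of the paper (with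
`1 ≤ i_l ≤ n - 1` and each `w_l` a positive word in `B_n`), and let `α ∈ B_{n+2}` be the
braid of equation (2), where the positive words are transported by the inclusion
`ι : B_n → B_{n+2}` sending `σ_i` to `σ_i`. If the image of `β` under the canonical
projection `π_n : B_n → S_n` (sending `σ_j` to the transposition `(j, j+1)`) is a cycle
of length `n`, then the image of `α` under `π_{n+2} : B_{n+2} → S_{n+2}` is a cycle of
length `n + 2`. -/
theorem alpha_closure_is_knot
    (n : ℕ) (hn : 2 ≤ n) (k : ℕ) (i : Fin k → ℕ)
    (hi : ∀ l : Fin k, 1 ≤ i l ∧ i l ≤ n - 1)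
    (w : Fin k → BraidGroup n)
    (hw : ∀ l : Fin k, w l ∈
      Submonoid.closure {x : BraidGroup n | ∃ j : ℕ, 1 ≤ j ∧ j ≤ n - 1 ∧ x = σ n j})
    (ι : BraidGroup n →* BraidGroup (n + 2))
    (hι : ∀ j : ℕ, 1 ≤ j → j ≤ n - 1 → ι (σ n j) = σ (n + 2) j)
    (πn : BraidGroup n →* Equiv.Perm (Fin n))
    (hπn : ∀ (j : ℕ) (h1 : 1 ≤ j) (h2 : j ≤ n - 1),
      πn (σ n j) = Equiv.swap (⟨j - 1, by omega⟩ : Fin n) (⟨j, by omega⟩ : Fin n))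
    (πn2 : BraidGroup (n + 2) →* Equiv.Perm (Fin (n + 2)))
    (hπn2 : ∀ (j : ℕ) (h1 : 1 ≤ j) (h2 : j ≤ n + 1),
      πn2 (σ (n + 2) j) = Equiv.swap (⟨j - 1, by omega⟩ : Fin (n + 2)) (⟨j, by omega⟩ : Fin (n + 2)))
    (hβ : (πn ((List.ofFn fun l : Fin k => (σ n (i l))⁻¹ * w l).prod)).IsCycle ∧
      (πn ((List.ofFn fun l : Fin k => (σ n (i l))⁻¹ * w l).prod)).support.card = n) :
    (πn2 (σ (n + 2) (n + 1) * σ (n + 2) n *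
        (List.ofFn fun l : Fin k =>
          σDesc (n + 2) n (i l) * σDesc (n + 2) (n + 1) (i l + 1) *
            (σ (n + 2) (i l + 2))⁻¹ * σ (n + 2) (i l + 1) *
            σAsc (n + 2) (i l + 2) (n + 1) * σAsc (n + 2) (i l) n * ι (w l)).prod)).IsCycle ∧
    (πn2 (σ (n + 2) (n + 1) * σ (n + 2) n *
        (List.ofFn fun l : Fin k =>
          σDesc (n + 2) n (i l) * σDesc (n + 2) (n + 1) (i l + 1) *
            (σ (n + 2) (i l + 2))⁻¹ * σ (n + 2) (i l + 1) *
            σAsc (n + 2) (i l + 2) (n + 1) * σAsc (n + 2) (i l) n * ι (w l)).prod)).support.card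
      = n + 2 := by
  let f : Fin n ≃ {x : Fin (n + 2) // (x : ℕ) < n} :=
    { toFun := fun x => ⟨⟨x, by omega⟩, x.2⟩
      invFun := fun x => ⟨x.1, x.2⟩
      left_inv := fun _ => rfl
      right_inv := fun _ => rfl }
  let E : Equiv.Perm (Fin n) →* Equiv.Perm (Fin (n + 2)) := Equiv.Perm.extendDomainHom f
  have hE (c : Equiv.Perm (Fin n)) : E c = c.extendDomain f := rfl
  have hgen (j : ℕ) (h1 : 1 ≤ j) (h2 : j ≤ n - 1) : E (πn (σ n j)) = πn2 (σ (n + 2) j) := by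
    rw [hπn j h1 h2, hπn2 j h1 (by omega), hE]
    ext x
    by_cases hx : (x : ℕ) < n
    · rw [Equiv.Perm.extendDomain_apply_subtype _ f hx]
      simp only [f, Equiv.swap_apply_def, Equiv.coe_fn_mk, Equiv.coe_fn_symm_mk, Fin.ext_iff]
      split_ifs <;> rfl
    · rw [Equiv.Perm.extendDomain_apply_not_subtype _ f hx,
        Equiv.swap_apply_of_ne_of_ne (by simp [Fin.ext_iff]; omega) (by simp [Fin.ext_iff]; omega)]
  have hword (l : Fin k) : πn2 (ι (w l)) = E (πn (w l)) := by
    have hwl := hw l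
    generalize w l = v at hwl ⊢
    induction hwl using Submonoid.closure_induction with
    | mem x hx =>
      obtain ⟨j, h1, h2, rfl⟩ := hx
      rw [hι j h1 h2, hgen j h1 h2]
    | one => simp
    | mul x y _ _ hx hy => simp only [map_mul, hx, hy]
  have hprod : πn2 (List.ofFn fun l : Fin k =>
      σDesc (n + 2) n (i l) * σDesc (n + 2) (n + 1) (i l + 1) *
        (σ (n + 2) (i l + 2))⁻¹ * σ (n + 2) (i l + 1) *
        σAsc (n + 2) (i l + 2) (n + 1) * σAsc (n + 2) (i l) n * ι (w l)).prod =
      E (πn (List.ofFn fun l : Fin k => (σ n (i l))⁻¹ * w l).prod) := by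
    simp only [map_list_prod, List.map_ofFn]
    congr 2
    funext l
    obtain ⟨h1, h2⟩ := hi l
    simp only [Function.comp_apply]
    rw [map_mul, map_block_eq πn2 (fun j h h' => hπn2 j h (by omega)) (i l) h1 (by omega), hword, map_mul, map_mul, map_inv,
      hπn (i l) h1 h2, Equiv.swap_inv, ← hπn (i l) h1 h2, hgen (i l) h1 h2]
  obtain ⟨hcyc, hcard⟩ := hβ
  rw [map_mul, hprod, map_mul]
  set c := πn (List.ofFn fun l : Fin k => (σ n (i l))⁻¹ * w l).prod
  have hcyc' : (E c).IsCycle := hcyc.extendDomain f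
  have hcard' : (E c).support.card = n := by rw [hE, Equiv.Perm.card_support_extend_domain, hcard]
  have hout (x : Fin (n + 2)) (hx : n ≤ (x : ℕ)) : x ∉ (E c).support := by
    rw [Equiv.Perm.notMem_support, hE]
    exact Equiv.Perm.extendDomain_apply_not_subtype _ f (by omega)
  have hin : (⟨n - 1, by omega⟩ : Fin (n + 2)) ∈ (E c).support := by
    have huniv : c.support = Finset.univ := by
      rw [← Finset.card_eq_iff_eq_univ, hcard, Fintype.card_fin]
    have hmem : (⟨n - 1, by omega⟩ : Fin n) ∈ c.support := huniv ▸ Finset.mem_univ _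
    rw [hE, Equiv.Perm.support_extend_domain]
    exact Finset.mem_map.2 ⟨_, hmem, rfl⟩
  rw [hπn2 (n + 1) (by omega) le_rfl, hπn2 n (by omega) (by omega), mul_assoc,
    Equiv.swap_comm _ (⟨n, _⟩ : Fin (n + 2)), Equiv.swap_comm _ (⟨n + 1, _⟩ : Fin (n + 2))]
  have hn0 := hout ⟨n, by omega⟩ le_rfl
  obtain ⟨hcyc₁, hsupp₁⟩ := isCycle_swap_mul_of_notMem_support hcyc' hin hn0
  have hn1 : (⟨n + 1, by omega⟩ : Fin (n + 2)) ∉ insert ⟨n, by omega⟩ (E c).support := by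
    rw [Finset.mem_insert, not_or]
    exact ⟨by simp, hout _ (by simp)⟩
  obtain ⟨hcyc₂, hsupp₂⟩ := isCycle_swap_mul_of_notMem_support hcyc₁
    (x := ⟨n, by omega⟩) (y := ⟨n + 1, by omega⟩)
    (by rw [hsupp₁]; exact Finset.mem_insert_self _ _) (by rw [hsupp₁]; exact hn1)
  refine ⟨hcyc₂, ?_⟩
  refine (congrArg Finset.card hsupp₂).trans ?_
  rw [hsupp₁, Finset.card_insert_of_notMem hn1, Finset.card_insert_of_notMem hn0, hcard']
end
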